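/- Let γ = (α, β) : ℝ → ℝ² be a real analytic L-periodic unit-speed curve with unit normal ν = (−β', α') and curvature κ (so γ'' = κν), and suppose the map Ψ(s,t) = γ(s) + tν(s) restricts to a diffeomorphism from (ℝ/Lℤ) × (−1,1) onto an open set Ω ⊂ ℝ². Define u : Ω → ℝ by u(Ψ(s,t)) = 1 − t². Then for all (s,t): Du(Ψ(s,t)) = (2tβ'(s), −2tα'(s)), so |Du(Ψ(s,t))| = 2|t|; Δu(Ψ(s,t)) = −2 + 2tκ(s)/(1 − tκ(s)); and det D²u(Ψ(s,t)) = −4tκ(s)/(1 − tκ(s)). In particular, u satisfies the rotationally invariant equation det D²u + 2Δu + 4 = 0 on Ω. -/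

import Mathlib

open Set Metric Topology Asymptotics MvPolynomial Matrix

/-- Partial derivative with respect to the first variable. -/
noncomputable def pdx (f : ℝ × ℝ → ℝ) (p : ℝ × ℝ) : ℝ :=
  deriv (fun x => f (x, p.2)) p.1

/-- Partial derivative with respect to the second variable. -/
noncomputable def pdy (f : ℝ × ℝ → ℝ) (p : ℝ × ℝ) : ℝ :=
  deriv (fun y => f (p.1, y)) p.2

/-- The Laplacian `Δu = u_xx + u_yy`. -/
noncomputable def lap (f : ℝ × ℝ → ℝ) (p : ℝ × ℝ) : ℝ :=
  pdx (pdx f) p + pdy (pdy f) p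

/-- The Hessian determinant `det D²u = u_xx u_yy - u_xy²`. -/
noncomputable def hessDet (f : ℝ × ℝ → ℝ) (p : ℝ × ℝ) : ℝ :=
  pdx (pdx f) p * pdy (pdy f) p - (pdx (pdy f) p) ^ 2

/-- The Jacobian `J[f,g] = f_x g_y - f_y g_x`. -/
noncomputable def jacDet (f g : ℝ × ℝ → ℝ) (p : ℝ × ℝ) : ℝ :=
  pdx f p * pdy g p - pdy f p * pdx g p

/-- The first partial derivative of a function that is locally equal to a differentiable one. -/
lemma pdx_eq_of_hasFDerivAt {f g : ℝ × ℝ → ℝ} {g' : ℝ × ℝ →L[ℝ] ℝ} {q : ℝ × ℝ}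
    (h : f =ᶠ[𝓝 q] g) (hg : HasFDerivAt g g' q) : pdx f q = g' (1, 0) := by
  have hline : HasDerivAt (fun x : ℝ => (x, q.2)) ((1 : ℝ), (0 : ℝ)) q.1 :=
    (hasDerivAt_id q.1).prodMk (hasDerivAt_const q.1 q.2)
  exact ((hg.congr_of_eventuallyEq h).comp_hasDerivAt q.1 hline).deriv

/-- The second partial derivative of a function that is locally equal to a differentiable one. -/
lemma pdy_eq_of_hasFDerivAt {f g : ℝ × ℝ → ℝ} {g' : ℝ × ℝ →L[ℝ] ℝ} {q : ℝ × ℝ}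
    (h : f =ᶠ[𝓝 q] g) (hg : HasFDerivAt g g' q) : pdy f q = g' (0, 1) := by
  have hline : HasDerivAt (fun y : ℝ => (q.1, y)) ((0 : ℝ), (1 : ℝ)) q.2 :=
    (hasDerivAt_const q.2 q.1).prodMk (hasDerivAt_id q.2)
  exact ((hg.congr_of_eventuallyEq h).comp_hasDerivAt q.2 hline).deriv

/-- The linear functional `(x, y) ↦ a x + b y`. -/
noncomputable def linForm (a b : ℝ) : ℝ × ℝ →L[ℝ] ℝ :=
  a • ContinuousLinearMap.fst ℝ ℝ ℝ + b • ContinuousLinearMap.snd ℝ ℝ ℝ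

@[simp]
lemma linForm_apply (a b : ℝ) (p : ℝ × ℝ) : linForm a b p = a * p.1 + b * p.2 := rfl

/-- The differential of tubular coordinates: `(1, 0) ↦ w (a, b)` and `(0, 1) ↦ (-b, a)`, for a
unit vector `(a, b)` and `w ≠ 0`. -/
noncomputable def tubularDifferential (a b w : ℝ) (hab : a ^ 2 + b ^ 2 = 1) (hw : w ≠ 0) :
    (ℝ × ℝ) ≃L[ℝ] (ℝ × ℝ) :=
  ContinuousLinearEquiv.equivOfInverse
    ((linForm (w * a) (-b)).prod (linForm (w * b) a))
    ((linForm (a / w) (b / w)).prod (linForm (-b) a))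
    (fun p => by
      ext
      · simp only [ContinuousLinearMap.prod_apply, linForm_apply]
        field_simp
        linear_combination w * p.1 * hab
      · simp only [ContinuousLinearMap.prod_apply, linForm_apply]
        linear_combination p.2 * hab)
    (fun p => by
      ext
      · simp only [ContinuousLinearMap.prod_apply, linForm_apply]
        field_simp
        linear_combination p.1 * hab
      · simp only [ContinuousLinearMap.prod_apply, linForm_apply]
        field_simp
        linear_combination p.2 * hab)

/-- Tubular coordinates around a unit-speed curve have local inverses `(S, T)`, with explicit
differentials at the base point. -/
lemma exists_local_tubular_coordinates {α β : ℝ → ℝ} {k s t : ℝ}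
    (hα : AnalyticAt ℝ α s) (hβ : AnalyticAt ℝ β s)
    (hunit : (deriv α s) ^ 2 + (deriv β s) ^ 2 = 1)
    (hk₁ : deriv (deriv α) s = k * (-(deriv β s)))
    (hk₂ : deriv (deriv β) s = k * deriv α s)
    (hreg : 1 - t * k ≠ 0) (q : ℝ × ℝ)
    (hq : q = (α s - t * deriv β s, β s + t * deriv α s)) :
    ∃ S T : ℝ × ℝ → ℝ, S q = s ∧ T q = t ∧
      (∀ᶠ p in 𝓝 q,
        (α (S p) - T p * deriv β (S p), β (S p) + T p * deriv α (S p)) = p) ∧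
      HasFDerivAt S (linForm (deriv α s / (1 - t * k)) (deriv β s / (1 - t * k))) q ∧
      HasFDerivAt T (linForm (-deriv β s) (deriv α s)) q := by
  let F : ℝ × ℝ → ℝ × ℝ := fun p =>
    (α p.1 - p.2 * deriv β p.1, β p.1 + p.2 * deriv α p.1)
  have hfst : HasStrictFDerivAt (fun p : ℝ × ℝ => p.1) (ContinuousLinearMap.fst ℝ ℝ ℝ) (s, t) :=
    hasStrictFDerivAt_fst
  have hsnd : HasStrictFDerivAt (fun p : ℝ × ℝ => p.2) (ContinuousLinearMap.snd ℝ ℝ ℝ) (s, t) :=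
    hasStrictFDerivAt_snd
  have hα₀ := hα.hasStrictDerivAt.comp_hasStrictFDerivAt (s, t) hfst
  have hβ₀ := hβ.hasStrictDerivAt.comp_hasStrictFDerivAt (s, t) hfst
  have hα₁ := hα.deriv.hasStrictDerivAt.comp_hasStrictFDerivAt (s, t) hfst
  have hβ₁ := hβ.deriv.hasStrictDerivAt.comp_hasStrictFDerivAt (s, t) hfst
  have hFd : HasStrictFDerivAt F
      (tubularDifferential (deriv α s) (deriv β s) (1 - t * k) hunit hreg :
        ℝ × ℝ →L[ℝ] ℝ × ℝ) (s, t) := by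
    refine ((hα₀.sub (hsnd.mul hβ₁)).prodMk (hβ₀.add (hsnd.mul hα₁))).congr_fderiv ?_
    ext <;> simp [tubularDifferential, hk₁, hk₂] <;> ring
  have hFq : F (s, t) = q := hq.symm
  have hG := hFd.to_localInverse.hasFDerivAt
  have hinv := hFd.eventually_right_inverse
  have hbase := hFd.localInverse_apply_image
  rw [hFq] at hG hinv hbase
  refine ⟨fun p => (hFd.localInverse F _ _ p).1, fun p => (hFd.localInverse F _ _ p).2,
    by simp only [hbase], by simp only [hbase], hinv, ?_, ?_⟩
  · exact hG.fst.congr_fderiv rfl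
  · exact hG.snd.congr_fderiv rfl

/-- **Example (annulus).** Let `γ = (α, β)` be a real analytic `L`-periodic unit-speed
curve with unit normal `ν = (−β', α')` and curvature `κ` (`γ'' = κν`), such that
`Ψ(s,t) = γ(s) + tν(s)` restricts to a diffeomorphism of `(ℝ/Lℤ) × (−1,1)` onto an open
set `Ω`, and define `u` on `Ω` by `u(Ψ(s,t)) = 1 − t²`.  Then
`Du(Ψ(s,t)) = (2tβ'(s), −2tα'(s))` (so `|Du| = 2|t|`),
`Δu(Ψ(s,t)) = −2 + 2tκ/(1−tκ)`, `det D²u(Ψ(s,t)) = −4tκ/(1−tκ)`, and in particular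
`det D²u + 2Δu + 4 = 0` on `Ω`. -/
theorem annulus_example_formulas
    (L : ℝ) (hL : 0 < L) (α β κ : ℝ → ℝ)
    (hα : AnalyticOnNhd ℝ α Set.univ) (hβ : AnalyticOnNhd ℝ β Set.univ)
    (hperα : ∀ s, α (s + L) = α s) (hperβ : ∀ s, β (s + L) = β s)
    (hunit : ∀ s, (deriv α s) ^ 2 + (deriv β s) ^ 2 = 1)
    (hκ₁ : ∀ s, deriv (deriv α) s = κ s * (-(deriv β s)))
    (hκ₂ : ∀ s, deriv (deriv β) s = κ s * deriv α s)
    (Ψ : ℝ → ℝ → ℝ × ℝ)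
    (hΨ : ∀ s t, Ψ s t = (α s - t * deriv β s, β s + t * deriv α s))
    (Ω : Set (ℝ × ℝ)) (hΩopen : IsOpen Ω)
    (hΩim : Ω = {q : ℝ × ℝ | ∃ s : ℝ, ∃ t ∈ Ioo (-1 : ℝ) 1, q = Ψ s t})
    -- `Ψ` is injective on `(ℝ/Lℤ) × (−1,1)` …
    (hinj : ∀ s₁ s₂ t₁ t₂ : ℝ, t₁ ∈ Ioo (-1 : ℝ) 1 → t₂ ∈ Ioo (-1 : ℝ) 1 →
      Ψ s₁ t₁ = Ψ s₂ t₂ → t₁ = t₂ ∧ ∃ j : ℤ, s₂ = s₁ + j * L)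
    -- … and a local diffeomorphism (its Jacobian `1 − tκ(s)` never vanishes)
    (hreg : ∀ s : ℝ, ∀ t ∈ Ioo (-1 : ℝ) 1, 1 - t * κ s ≠ 0)
    (u : ℝ × ℝ → ℝ)
    (hu : ∀ s : ℝ, ∀ t ∈ Ioo (-1 : ℝ) 1, u (Ψ s t) = 1 - t ^ 2) :
    ∀ s : ℝ, ∀ t ∈ Ioo (-1 : ℝ) 1,
      pdx u (Ψ s t) = 2 * t * deriv β s ∧
      pdy u (Ψ s t) = -(2 * t * deriv α s) ∧
      Real.sqrt ((pdx u (Ψ s t)) ^ 2 + (pdy u (Ψ s t)) ^ 2) = 2 * |t| ∧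
      lap u (Ψ s t) = -2 + 2 * t * κ s / (1 - t * κ s) ∧
      hessDet u (Ψ s t) = -(4 * t * κ s) / (1 - t * κ s) ∧
      hessDet u (Ψ s t) + 2 * lap u (Ψ s t) + 4 = 0 := by
  have hcoord : ∀ s : ℝ, ∀ t ∈ Ioo (-1 : ℝ) 1, ∃ S T : ℝ × ℝ → ℝ,
      S (Ψ s t) = s ∧ T (Ψ s t) = t ∧
      (∀ᶠ p in 𝓝 (Ψ s t), T p ∈ Ioo (-1 : ℝ) 1 ∧ Ψ (S p) (T p) = p) ∧
      HasFDerivAt S (linForm (deriv α s / (1 - t * κ s)) (deriv β s / (1 - t * κ s))) (Ψ s t) ∧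
      HasFDerivAt T (linForm (-deriv β s) (deriv α s)) (Ψ s t) := by
    intro s t ht
    obtain ⟨S, T, hS, hT, hinv, hdS, hdT⟩ :=
      exists_local_tubular_coordinates (hα s trivial) (hβ s trivial) (hunit s) (hκ₁ s) (hκ₂ s)
        (hreg s t ht) (Ψ s t) (hΨ s t)
    refine ⟨S, T, hS, hT, ?_, hdS, hdT⟩
    have hmem : ∀ᶠ p in 𝓝 (Ψ s t), T p ∈ Ioo (-1 : ℝ) 1 :=
      hdT.continuousAt.eventually_mem (isOpen_Ioo.mem_nhds (by rwa [hT]))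
    filter_upwards [hmem, hinv] with p hp hp'
    exact ⟨hp, by rw [hΨ, hp']⟩
  have hgrad : ∀ s : ℝ, ∀ t ∈ Ioo (-1 : ℝ) 1,
      pdx u (Ψ s t) = 2 * t * deriv β s ∧ pdy u (Ψ s t) = -(2 * t * deriv α s) := by
    intro s t ht
    obtain ⟨S, T, -, hT, hloc, -, hdT⟩ := hcoord s t ht
    have hueq : u =ᶠ[𝓝 (Ψ s t)] fun p => 1 - T p ^ 2 := by
      filter_upwards [hloc] with p hp
      rw [← hu (S p) (T p) hp.1, hp.2]
    have hd := (hdT.pow 2).const_sub 1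
    rw [pdx_eq_of_hasFDerivAt hueq hd, pdy_eq_of_hasFDerivAt hueq hd]
    constructor <;> simp [hT]
  intro s t ht
  obtain ⟨hx, hy⟩ := hgrad s t ht
  obtain ⟨S, T, hS, hT, hloc, hdS, hdT⟩ := hcoord s t ht
  have hw := hreg s t ht
  have hxeq : pdx u =ᶠ[𝓝 (Ψ s t)] fun p => 2 * T p * deriv β (S p) := by
    filter_upwards [hloc] with p hp
    rw [← (hgrad (S p) (T p) hp.1).1, hp.2]
  have hyeq : pdy u =ᶠ[𝓝 (Ψ s t)] fun p => -(2 * T p * deriv α (S p)) := by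
    filter_upwards [hloc] with p hp
    rw [← (hgrad (S p) (T p) hp.1).2, hp.2]
  have hα' : HasDerivAt (deriv α) (κ s * (-(deriv β s))) (S (Ψ s t)) := by
    rw [hS, ← hκ₁]
    exact (hα s trivial).deriv.differentiableAt.hasDerivAt
  have hβ' : HasDerivAt (deriv β) (κ s * deriv α s) (S (Ψ s t)) := by
    rw [hS, ← hκ₂]
    exact (hβ s trivial).deriv.differentiableAt.hasDerivAt
  have hdx := (hdT.const_mul 2).mul (hβ'.comp_hasFDerivAt _ hdS)
  have hdy := ((hdT.const_mul 2).mul (hα'.comp_hasFDerivAt _ hdS)).neg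
  have hxx : pdx (pdx u) (Ψ s t) =
      -2 * deriv β s ^ 2 + 2 * t * κ s * deriv α s ^ 2 / (1 - t * κ s) := by
    rw [pdx_eq_of_hasFDerivAt hxeq hdx]
    simp [hS, hT]
    ring
  have hyy : pdy (pdy u) (Ψ s t) =
      -2 * deriv α s ^ 2 + 2 * t * κ s * deriv β s ^ 2 / (1 - t * κ s) := by
    rw [pdy_eq_of_hasFDerivAt hyeq hdy]
    simp [hS, hT]
    ring
  have hxy : pdx (pdy u) (Ψ s t) =
      2 * deriv α s * deriv β s + 2 * t * κ s * deriv α s * deriv β s / (1 - t * κ s) := by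
    rw [pdx_eq_of_hasFDerivAt hyeq hdy]
    simp [hS, hT]
    ring
  have hβsq : deriv β s ^ 2 = 1 - deriv α s ^ 2 := by linear_combination hunit s
  have hlap : lap u (Ψ s t) = -2 + 2 * t * κ s / (1 - t * κ s) := by
    rw [lap, hxx, hyy, hβsq]
    ring
  have hdet : hessDet u (Ψ s t) = -(4 * t * κ s) / (1 - t * κ s) := by
    have hsq : pdx (pdy u) (Ψ s t) ^ 2 =
        deriv α s ^ 2 * deriv β s ^ 2 * (2 + 2 * t * κ s / (1 - t * κ s)) ^ 2 := by
      rw [hxy]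
      ring
    rw [hessDet, hsq, hxx, hyy, hβsq]
    field_simp
    ring
  refine ⟨hx, hy, ?_, hlap, hdet, ?_⟩
  · have hsum : (2 * t * deriv β s) ^ 2 + (-(2 * t * deriv α s)) ^ 2 = (2 * t) ^ 2 := by
      linear_combination 4 * t ^ 2 * hunit s
    rw [hx, hy, hsum, Real.sqrt_sq_eq_abs, abs_mul, abs_two]
  · rw [hlap, hdet]
    ring
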